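/- arXiv:1704.07112 — 2 statements merged into one kernel-verified Lean document; each statement's English description precedes it below -/
import Mathlib

section
/- Let D = (d_1,...,d_n) be a tree degree sequence, let U = {v_i : d_i > 1} and L = V \ U, and let n > m > 2. Suppose V_1,...,V_{m−1} are pairwise disjoint subsets of L with |U| > 1 and |V_j| > 1 for all j, and d_i ≤ n − m for all i. Then there is a labeled tree T realizing D such that for every j, the subgraph of T induced on U ∪ V_j is a tree that is not a star. -/
/-- `G` realizes the degree sequence `d`: vertex `v` has degree `d v`. -/
def realizes {n : ℕ} (G : SimpleGraph (Fin n)) (d : Fin n → ℕ) : Prop :=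
  ∀ v, {u | G.Adj v u}.ncard = d v

/-- A tree degree sequence: positive entries summing to `2n - 2`. -/
def isTreeSeq {n : ℕ} (d : Fin n → ℕ) : Prop :=
  (∀ i, 1 ≤ d i) ∧ (∑ i, d i) = 2 * n - 2

/-- A caterpillar: a tree whose non-leaf vertices span a path. -/
def isCaterpillar {n : ℕ} (T : SimpleGraph (Fin n)) : Prop :=
  T.IsTree ∧ ∃ p : List (Fin n), p.Nodup ∧ p.Chain' T.Adj ∧
    ∀ v, (1 < {u | T.Adj v u}.ncard ↔ v ∈ p)

theorem tnr_step {α : Type*} [DecidableEq α] (c : α → ℕ) (b : α) (A : Finset α) (hb : b ∉ A)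
    (h : ∀ S : Finset α, S.card = ∑ u ∈ A, c u →
      ∃ f : α → α, (∀ x ∈ S, f x ∈ A) ∧ ∀ u ∈ A, (S.filter (fun x => f x = u)).card = c u)
    (S X Y : Finset α) (hS : S.card = c b + ∑ u ∈ A, c u) (hX : X ⊆ S) (hY : Y ⊆ S)
    (hXY : Disjoint X Y) (hXc : X.card + c b ≤ S.card) (hYc : Y.card ≤ c b) :
    ∃ f : α → α, (∀ x ∈ S, f x ∈ insert b A) ∧
      (∀ u ∈ insert b A, (S.filter (fun x => f x = u)).card = c u) ∧
      (∀ x ∈ X, f x ≠ b) ∧ ∀ y ∈ Y, f y = b := by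
  obtain ⟨B, hYB, hBS, hBc⟩ := Finset.exists_subsuperset_card_eq
    (s := Y) (t := S \ X) (n := c b)
    (by
      intro y hy
      exact Finset.mem_sdiff.2 ⟨hY hy, fun hx => Finset.disjoint_left.1 hXY hx hy⟩)
    hYc (by rw [Finset.card_sdiff_of_subset hX]; omega)
  have hBS' : B ⊆ S := hBS.trans Finset.sdiff_subset
  obtain ⟨g, hg1, hg2⟩ := h (S \ B) (by rw [Finset.card_sdiff_of_subset hBS']; omega)
  refine ⟨fun x => if x ∈ B then b else g x, ?_, ?_, ?_, ?_⟩
  · intro x hx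
    by_cases hxB : x ∈ B
    · simp [hxB]
    · simp only [hxB, if_false]
      exact Finset.mem_insert_of_mem (hg1 x (Finset.mem_sdiff.2 ⟨hx, hxB⟩))
  · intro u hu
    rcases Finset.mem_insert.1 hu with rfl | huA
    · rw [← hBc]
      congr 1
      ext x
      have := hg1 x
      have := @hBS' x
      simp only [Finset.mem_filter, Finset.mem_sdiff] at *
      by_cases hxB : x ∈ B
      · simp_all
      · simp only [hxB, if_false, iff_false]
        rintro ⟨h1, h2⟩
        exact hb (h2 ▸ hg1 x ⟨h1, hxB⟩)
    · rw [← hg2 u huA]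
      congr 1
      ext x
      have hne : b ≠ u := fun h => hb (h ▸ huA)
      by_cases hxB : x ∈ B <;> simp [hxB, hne]
  · intro x hx
    have hxB : x ∉ B := fun h => (Finset.mem_sdiff.1 (hBS h)).2 hx
    simp only [hxB, if_false]
    intro h2
    exact hb (h2 ▸ hg1 x (Finset.mem_sdiff.2 ⟨hX hx, hxB⟩))
  · intro y hy
    simp [hYB hy]

theorem tnr_fill {α : Type*} [DecidableEq α] (c : α → ℕ) (A : Finset α) :
    ∀ S : Finset α, S.card = ∑ u ∈ A, c u →
      ∃ f : α → α, (∀ x ∈ S, f x ∈ A) ∧ ∀ u ∈ A, (S.filter (fun x => f x = u)).card = c u := by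
  induction A using Finset.induction_on with
  | empty =>
    intro S hS
    simp at hS
    subst hS
    exact ⟨id, by simp, by simp⟩
  | insert b A hb ih =>
    intro S hS
    rw [Finset.sum_insert hb] at hS
    obtain ⟨f, h1, h2, -⟩ := tnr_step c b A hb ih S ∅ ∅ hS (by simp) (by simp) (by simp)
      (by simp; omega) (by simp)
    exact ⟨f, h1, h2⟩

theorem tnr_fill' {α : Type*} [DecidableEq α] (c : α → ℕ) (A : Finset α) (b : α) (hb : b ∈ A)
    (S X Y : Finset α) (hS : S.card = ∑ u ∈ A, c u) (hX : X ⊆ S) (hY : Y ⊆ S)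
    (hXY : Disjoint X Y) (hXc : X.card + c b ≤ S.card) (hYc : Y.card ≤ c b) :
    ∃ f : α → α, (∀ x ∈ S, f x ∈ A) ∧
      (∀ u ∈ A, (S.filter (fun x => f x = u)).card = c u) ∧
      (∀ x ∈ X, f x ≠ b) ∧ ∀ y ∈ Y, f y = b := by
  have := tnr_step c b (A.erase b) (by simp) (tnr_fill c _) S X Y
    (by rw [hS, ← Finset.add_sum_erase _ _ hb]) hX hY hXY hXc hYc
  rwa [Finset.insert_erase hb] at this

/-- graph of a parent function -/
def tnrG {V : Type*} (r : V) (p : V → V) (rk : V → ℕ)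
    (h : ∀ v, v ≠ r → rk (p v) < rk v) : SimpleGraph V where
  Adj x y := (x ≠ r ∧ p x = y) ∨ (y ≠ r ∧ p y = x)
  symm := ⟨fun x y hxy => hxy.symm⟩
  loopless := ⟨by
    rintro x (⟨h1, h2⟩ | ⟨h1, h2⟩) <;>
    · have := h x h1
      rw [h2] at this
      omega⟩

theorem tnrG_conn {V : Type*} (r : V) (p : V → V) (rk : V → ℕ)
    (h : ∀ v, v ≠ r → rk (p v) < rk v) (s : Set V) (hr : r ∈ s)
    (hs : ∀ v ∈ s, v ≠ r → p v ∈ s) : ((tnrG r p rk h).induce s).Connected := by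
  have key : ∀ k, ∀ v (hv : v ∈ s), rk v ≤ k →
      ((tnrG r p rk h).induce s).Reachable ⟨v, hv⟩ ⟨r, hr⟩ := by
    intro k
    induction k with
    | zero =>
      intro v hv hk
      by_cases hvr : v = r
      · subst hvr; exact SimpleGraph.Reachable.refl _
      · have := h v hvr; omega
    | succ k ih =>
      intro v hv hk
      by_cases hvr : v = r
      · subst hvr; exact SimpleGraph.Reachable.refl _
      · have h1 := h v hvr
        refine SimpleGraph.Reachable.trans ?_ (ih (p v) (hs v hv hvr) (by omega))
        apply SimpleGraph.Adj.reachable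
        exact Or.inl ⟨hvr, rfl⟩
  have : Nonempty s := ⟨⟨r, hr⟩⟩
  refine ⟨fun a b => ?_⟩
  exact (key _ a.1 a.2 le_rfl).trans (key _ b.1 b.2 le_rfl).symm

theorem tnrG_tree {V : Type*} [Fintype V] [DecidableEq V] (r : V) (p : V → V) (rk : V → ℕ)
    (h : ∀ v, v ≠ r → rk (p v) < rk v) : (tnrG r p rk h).IsTree := by
  classical
  rw [SimpleGraph.isTree_iff_connected_and_card]
  constructor
  · have h1 := tnrG_conn r p rk h Set.univ (by simp) (by simp)
    exact (SimpleGraph.induceUnivIso (tnrG r p rk h)).connected_iff.1 h1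
  · have : (tnrG r p rk h).edgeSet =
        (((Finset.univ.erase r).image (fun v => s(v, p v)) : Finset (Sym2 V)) : Set (Sym2 V)) := by
      ext e
      induction e using Sym2.ind with
      | _ x y =>
        simp only [SimpleGraph.mem_edgeSet, Finset.coe_image, Set.mem_image, Finset.coe_erase,
          Finset.coe_univ, Set.mem_diff, Set.mem_univ, true_and, Set.mem_singleton_iff,
          Sym2.eq_iff]
        constructor
        · rintro (⟨h1, h2⟩ | ⟨h1, h2⟩)
          · exact ⟨x, h1, Or.inl ⟨rfl, h2⟩⟩
          · exact ⟨y, h1, Or.inr ⟨rfl, h2⟩⟩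
        · rintro ⟨v, h1, (⟨rfl, h3⟩ | ⟨rfl, h3⟩)⟩
          · exact Or.inl ⟨h1, h3⟩
          · exact Or.inr ⟨h1, h3⟩
    rw [this, Nat.card_coe_set_eq, Set.ncard_coe_finset, Finset.card_image_of_injOn]
    · rw [Finset.card_erase_of_mem (Finset.mem_univ r), Finset.card_univ, Nat.card_eq_fintype_card]
      have : 0 < Fintype.card V := Fintype.card_pos_iff.2 ⟨r⟩
      omega
    · intro v hv w hw hvw
      simp only [Finset.coe_erase, Finset.coe_univ, Set.mem_diff, Set.mem_univ, true_and,
        Set.mem_singleton_iff] at hv hw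
      rcases Sym2.eq_iff.1 hvw with ⟨h1, -⟩ | ⟨h1, h2⟩
      · exact h1
      · have a := h v hv
        have b := h w hw
        rw [← h1] at b
        rw [h2] at a
        omega

theorem tnrG_deg {V : Type*} [Fintype V] [DecidableEq V] (r : V) (p : V → V) (rk : V → ℕ)
    (h : ∀ v, v ≠ r → rk (p v) < rk v) (v : V) :
    {u | (tnrG r p rk h).Adj v u}.ncard =
      (if v = r then 0 else 1) + (Finset.univ.filter (fun x => x ≠ r ∧ p x = v)).card := by
  have e : {u | (tnrG r p rk h).Adj v u} =
      (((if v = r then ∅ else {p v}) ∪ (Finset.univ.filter (fun x => x ≠ r ∧ p x = v)) :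
        Finset V) : Set V) := by
    ext u
    simp only [tnrG, Set.mem_setOf_eq]
    by_cases hv : v = r
    · simp [hv]
    · simp [hv, eq_comm]
  rw [e, Set.ncard_coe_finset, Finset.card_union_of_disjoint]
  · split_ifs <;> simp
  · split_ifs with hv
    · simp
    · simp only [Finset.disjoint_singleton_left, Finset.mem_filter, Finset.mem_univ, true_and]
      rintro ⟨h1, h2⟩
      have a := h v hv
      have b := h _ h1
      rw [h2] at b
      omega

theorem tnr_index {n : ℕ} (U : Finset (Fin n)) (hU : 1 < U.card) :
    ∃ (u : ℕ → Fin n) (idx : Fin n → ℕ), (∀ i < U.card, u i ∈ U ∧ idx (u i) = i) ∧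
      ∀ v ∈ U, idx v < U.card ∧ u (idx v) = v := by
  have e := U.equivFin
  obtain ⟨z, hz⟩ := Finset.card_pos.1 (by omega : 0 < U.card)
  refine ⟨fun i => if h : i < U.card then (e.symm ⟨i, h⟩).1 else z,
    fun v => if h : v ∈ U then (e ⟨v, h⟩).1 else 0, ?_, ?_⟩
  · intro i hi
    simp [hi]
  · intro v hv
    simp [hv]

theorem tnr_sums (k : ℕ) (hk : 1 < k) :
    ∑ i ∈ Finset.range k, ((if i = 0 then 0 else 1) + (if i + 1 < k then 1 else 0)) = 2 * k - 2 := by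
  rw [Finset.sum_add_distrib]
  obtain ⟨k, rfl⟩ : ∃ l, k = l + 1 := ⟨k - 1, by omega⟩
  rw [Finset.sum_range_succ', Finset.sum_range_succ (fun i => if i + 1 < k + 1 then 1 else 0)]
  have e1 : ∑ i ∈ Finset.range k, (if i + 1 = 0 then 0 else 1) = k := by simp
  have e2 : ∑ i ∈ Finset.range k, (if i + 1 < k + 1 then 1 else 0) = k := by
    rw [Finset.sum_congr rfl (g := fun _ => 1)
      (by intro i hi; have := Finset.mem_range.1 hi; simp [this])]
    simp
  rw [e1, e2]
  simp
  omega

theorem tree_with_nonstar_restrictions (n m : ℕ) (hm : 2 < m) (hmn : m < n)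
    (d : Fin n → ℕ) (hd : isTreeSeq d)
    (Vs : Fin (m - 1) → Set (Fin n))
    (hsub : ∀ j, Vs j ⊆ {i | d i = 1})
    (hdisj : ∀ j k, j ≠ k → Disjoint (Vs j) (Vs k))
    (hU : 1 < {i | 1 < d i}.ncard)
    (hVs : ∀ j, 1 < (Vs j).ncard)
    (hdb : ∀ i, d i ≤ n - m) :
    ∃ T : SimpleGraph (Fin n), T.IsTree ∧ realizes T d ∧
      ∀ j, (T.induce ({i | 1 < d i} ∪ Vs j)).IsTree ∧
        ¬ ∃ c, ∀ w, w ≠ c → (T.induce ({i | 1 < d i} ∪ Vs j)).Adj c w := by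
  classical
  obtain ⟨hd1, hds⟩ := hd
  obtain ⟨U, hUdef⟩ : ∃ U : Finset (Fin n), U = Finset.univ.filter (fun i => 1 < d i) := ⟨_, rfl⟩
  have hUm : ∀ v, v ∈ U ↔ 1 < d v := by intro v; simp [hUdef]
  have hUs : {i | 1 < d i} = (U : Set (Fin n)) := by ext v; simp [hUm]
  rw [hUs, Set.ncard_coe_finset] at hU
  have hxy : ∀ j, ∃ x y, x ∈ Vs j ∧ y ∈ Vs j ∧ x ≠ y := by
    intro j
    obtain ⟨x, hx, y, hy, hne⟩ := (Set.one_lt_ncard).1 (hVs j)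
    exact ⟨x, y, hx, hy, hne⟩
  choose x y hx hy hne using hxy
  obtain ⟨u, idx, hu, hidx⟩ := tnr_index U hU
  obtain ⟨k, hk⟩ : ∃ k, k = U.card := ⟨_, rfl⟩
  rw [← hk] at hu hidx hU
  obtain ⟨L, hL⟩ : ∃ L : Finset (Fin n), L = Uᶜ := ⟨_, rfl⟩
  have hLm : ∀ v, v ∈ L ↔ d v = 1 := by
    intro v
    have := hd1 v
    simp only [hL, Finset.mem_compl, hUm]
    omega
  have hLc : L.card = n - k := by rw [hL, Finset.card_compl, ← hk, Fintype.card_fin]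
  have hkn : k ≤ n := by rw [hk]; simpa using Finset.card_le_univ U
  obtain ⟨c, hc⟩ : ∃ c : Fin n → ℕ, c = fun v =>
    d v - ((if idx v = 0 then 0 else 1) + (if idx v + 1 < k then 1 else 0)) := ⟨_, rfl⟩
  have hcd : ∀ v ∈ U, c v + ((if idx v = 0 then 0 else 1) + (if idx v + 1 < k then 1 else 0))
      = d v := by
    intro v hv
    have := (hUm v).1 hv
    rw [hc]
    dsimp only
    split_ifs <;> omega
  have hsumidx : ∑ v ∈ U, ((if idx v = 0 then 0 else 1) + (if idx v + 1 < k then 1 else 0))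
      = 2 * k - 2 := by
    rw [← tnr_sums k hU]
    refine Finset.sum_bij' (fun v _ => idx v) (fun i _ => u i) ?_ ?_ ?_ ?_ ?_
    · intro v hv; exact Finset.mem_range.2 (hidx v hv).1
    · intro i hi; exact (hu i (Finset.mem_range.1 hi)).1
    · intro v hv; exact (hidx v hv).2
    · intro i hi; exact (hu i (Finset.mem_range.1 hi)).2
    · intro v hv; rfl
  have hsumd : ∑ v ∈ U, d v + L.card = 2 * n - 2 := by
    rw [← hds, ← Finset.sum_add_sum_compl U, ← hL,
      Finset.sum_congr (s₁ := L) rfl (fun v hv => (hLm v).1 hv)]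
    simp
  have hsumc : L.card = ∑ v ∈ U, c v := by
    rw [← Finset.sum_congr rfl hcd, Finset.sum_add_distrib, hsumidx] at hsumd
    omega
  have hb := hu 1 hU
  have h0 := hu 0 (by omega)
  have hcb : c (u 1) + 1 + (if 2 < k then 1 else 0) = d (u 1) := by
    have := hcd _ hb.1
    rw [hb.2] at this
    simpa [add_assoc] using this
  have hc0 : c (u 0) + 1 = d (u 0) := by
    have := hcd _ h0.1
    rw [h0.2] at this
    simpa [hU] using this
  have hdb1 := hdb (u 1)
  have hdb0 := hdb (u 0)
  have hXc : (Finset.univ.image x).card ≤ m - 1 := by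
    simpa using Finset.card_image_le (s := Finset.univ) (f := x)
  have hYc : (Finset.univ.image y).card ≤ m - 1 := by
    simpa using Finset.card_image_le (s := Finset.univ) (f := y)
  have hXL : (Finset.univ.image x) ⊆ L := by
    intro v hv
    obtain ⟨j, -, rfl⟩ := Finset.mem_image.1 hv
    exact (hLm _).2 (hsub j (hx j))
  have hYL : (Finset.univ.image y) ⊆ L := by
    intro v hv
    obtain ⟨j, -, rfl⟩ := Finset.mem_image.1 hv
    exact (hLm _).2 (hsub j (hy j))
  have hXY : Disjoint (Finset.univ.image x) (Finset.univ.image y) := by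
    rw [Finset.disjoint_left]
    intro v hv hw
    obtain ⟨j, -, rfl⟩ := Finset.mem_image.1 hv
    obtain ⟨i, -, h⟩ := Finset.mem_image.1 hw
    by_cases hij : i = j
    · subst hij; exact hne i h.symm
    · exact Set.disjoint_left.1 (hdisj i j hij) (hy i) (h ▸ hx j)
  have hf : ∃ f : Fin n → Fin n, (∀ v ∈ L, f v ∈ U) ∧
      (∀ v ∈ U, (L.filter (fun x => f x = v)).card = c v) ∧
      (k ≤ 3 → ∀ j, f (x j) ≠ u 1) ∧ (k = 2 → ∀ j, f (y j) = u 1) := by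
    rcases (by omega : k = 2 ∨ k = 3 ∨ 4 ≤ k) with h2 | h3 | h4
    · have hU2 : U.card = c (u 0) + c (u 1) - L.card + 2 := by
        have : U = {u 0, u 1} := by
          symm
          apply Finset.eq_of_subset_of_card_le
          · intro v hv
            simp only [Finset.mem_insert, Finset.mem_singleton] at hv
            rcases hv with rfl | rfl
            · exact h0.1
            · exact hb.1
          · rw [Finset.card_pair (fun h => by have := h0.2; rw [h, hb.2] at this; omega)]
            omega
        have hs : ∑ v ∈ U, c v = c (u 0) + c (u 1) := by
          rw [this, Finset.sum_pair (fun h => by have := h0.2; rw [h, hb.2] at this; omega)]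
        omega
      have hle : c (u 0) + c (u 1) ≤ L.card := by omega
      have hge : L.card ≤ c (u 0) + c (u 1) := by
        rw [hsumc]
        have : U ⊆ {u 0, u 1} := by
          intro v hv
          have h := hidx v hv
          rw [← h.2]
          have : idx v = 0 ∨ idx v = 1 := by omega
          rcases this with h | h <;> simp [h]
        refine (Finset.sum_le_sum_of_subset this).trans ?_
        rw [Finset.sum_pair (fun h => by have := h0.2; rw [h, hb.2] at this; omega)]
      have hif : ¬ 2 < k := by omega
      simp only [hif, if_false] at hcb
      obtain ⟨f, h1, h2', h3, h4⟩ := tnr_fill' c U (u 1) hb.1 L _ _ hsumc hXL hYL hXY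
        (by omega) (by omega)
      exact ⟨f, h1, h2', fun _ j => h3 _ (by simp), fun _ j => h4 _ (by simp)⟩
    · have hif : 2 < k := by omega
      simp only [hif, if_true] at hcb
      obtain ⟨f, h1, h2', h3, h4⟩ := tnr_fill' c U (u 1) hb.1 L _ ∅ hsumc hXL (by simp)
        (by simp) (by omega) (by simp)
      exact ⟨f, h1, h2', fun _ j => h3 _ (by simp), fun _ j => by omega⟩
    · obtain ⟨f, h1, h2⟩ := tnr_fill c U L hsumc
      exact ⟨f, h1, h2, fun _ => by omega, fun _ => by omega⟩
  obtain ⟨f, hfU, hfc, hfx, hfy⟩ := hf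
  obtain ⟨p, hp⟩ : ∃ p : Fin n → Fin n, p = fun v => if v ∈ U then u (idx v - 1) else f v :=
    ⟨_, rfl⟩
  have hpU : ∀ v ∈ U, p v = u (idx v - 1) := by intro v hv; simp [hp, hv]
  have hpL : ∀ v ∈ L, p v = f v := by
    intro v hv
    have : v ∉ U := by simpa [hL] using hv
    simp [hp, this]
  have hUL : ∀ v, v ∈ U ∨ v ∈ L := by intro v; rw [hL, Finset.mem_compl]; exact em _
  have hUnL : ∀ v, v ∈ U → v ∉ L := by intro v hv; simp [hL, hv]
  have hpm : ∀ v, p v ∈ U := by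
    intro v
    rcases hUL v with h | h
    · rw [hpU v h]; exact (hu _ (by have := hidx v h; omega)).1
    · rw [hpL v h]; exact hfU v h
  have hroot : ∀ v ∈ U, v ≠ u 0 → idx v ≠ 0 := by
    intro v hv h1 h2
    apply h1
    rw [← h2, (hidx v hv).2]
  have hpi : ∀ v ∈ U, v ≠ u 0 → idx (p v) + 1 = idx v := by
    intro v hv h1
    have := hroot v hv h1
    have h3 := hidx v hv
    rw [hpU v hv, (hu _ (by omega)).2]
    omega
  have hrk : ∀ v, v ≠ u 0 → (if p v ∈ U then idx (p v) else k) < (if v ∈ U then idx v else k) := by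
    intro v hv
    rw [if_pos (hpm v)]
    split_ifs with h
    · have := hpi v h hv; omega
    · exact (hidx _ (hpm v)).1
  refine ⟨tnrG (u 0) p (fun v => if v ∈ U then idx v else k) hrk, tnrG_tree _ _ _ _, ?_, ?_⟩
  · intro v
    rw [tnrG_deg]
    rcases hUL v with h | h
    · rw [← hcd v h, ← hfc v h]
      have e : Finset.univ.filter (fun w => w ≠ u 0 ∧ p w = v) =
          L.filter (fun w => f w = v) ∪ (if idx v + 1 < k then {u (idx v + 1)} else ∅) := by
        ext w
        simp only [Finset.mem_filter, Finset.mem_univ, true_and, Finset.mem_union]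
        rcases hUL w with hw | hw
        · have hwL := hUnL w hw
          simp only [hwL, false_and, false_or]
          constructor
          · rintro ⟨h1, h2⟩
            have h3 := hpi w hw h1
            have h4 := hidx w hw
            rw [h2] at h3
            rw [if_pos (by omega), Finset.mem_singleton, h3, h4.2]
          · intro h1
            split_ifs at h1 with h2
            · rw [Finset.mem_singleton] at h1
              have h3 := (hu _ h2).2
              have hw0 : w ≠ u 0 := by
                intro h5
                rw [← h1, h5, h0.2] at h3
                omega
              refine ⟨hw0, ?_⟩
              rw [hpU w hw, h1, h3, Nat.add_sub_cancel, (hidx v h).2]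
            · simp at h1
        · have hw0 : w ≠ u 0 := fun h5 => hUnL _ h0.1 (h5 ▸ hw)
          have h6 : w ∉ (if idx v + 1 < k then {u (idx v + 1)} else ∅ : Finset (Fin n)) := by
            split_ifs with h2
            · rw [Finset.mem_singleton]
              intro h5
              exact hUnL _ (hu _ h2).1 (h5 ▸ hw)
            · simp
          simp [hw0, hw, h6, hpL w hw]
      rw [e, Finset.card_union_of_disjoint]
      · have e1 : (v = u 0) ↔ idx v = 0 := by
          constructor
          · rintro rfl; exact h0.2
          · intro h1; rw [← h1, (hidx v h).2]
        have e2 : (if idx v + 1 < k then {u (idx v + 1)} else ∅ : Finset (Fin n)).card =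
          if idx v + 1 < k then 1 else 0 := by split_ifs <;> simp
        rw [e2]
        simp only [e1]
        omega
      · rw [Finset.disjoint_left]
        intro w hw hw2
        split_ifs at hw2 with h2
        · rw [Finset.mem_singleton] at hw2
          exact hUnL _ (hu _ h2).1 (hw2 ▸ (Finset.mem_filter.1 hw).1)
        · simp at hw2
    · have hv0 : v ≠ u 0 := fun h5 => hUnL _ h0.1 (h5 ▸ h)
      have e : Finset.univ.filter (fun w => w ≠ u 0 ∧ p w = v) = ∅ := by
        apply Finset.filter_eq_empty_iff.2
        rintro w - ⟨-, h2⟩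
        exact hUnL _ (hpm w) (h2 ▸ h)
      rw [e, if_neg hv0, (hLm v).1 h]
      rfl
  · intro j
    have hVL : ∀ v ∈ Vs j, v ∈ L := fun v hv => (hLm v).2 (hsub j hv)
    rw [hUs]
    refine ⟨⟨tnrG_conn _ _ _ _ _ (Or.inl h0.1) (fun v _ _ => Or.inl (hpm v)),
      (tnrG_tree _ _ _ hrk).isAcyclic.induce _⟩, ?_⟩
    rintro ⟨⟨z, hz⟩, hstar⟩
    have hst : ∀ w, w ∈ (U : Set (Fin n)) ∪ Vs j → w ≠ z →
        (z ≠ u 0 ∧ p z = w) ∨ (w ≠ u 0 ∧ p w = z) := by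
      intro w hw hwz
      exact hstar ⟨w, hw⟩ (fun h => hwz (congrArg Subtype.val h))
    have hzU : z ∈ U := by
      rcases hz with hz | hz
      · exact hz
      · exfalso
        have hzL := hVL z hz
        have : ∃ w ∈ Vs j, w ≠ z := by
          by_cases h : x j = z
          · exact ⟨y j, hy j, fun h' => hne j (h.trans h'.symm)⟩
          · exact ⟨x j, hx j, h⟩
        obtain ⟨w, hw, hwz⟩ := this
        rcases hst w (Or.inr hw) hwz with h | h
        · exact hUnL _ (hpm z) (h.2 ▸ hVL w hw)
        · exact hUnL _ (hpm w) (h.2 ▸ hzL)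
    have hleaf : ∀ w ∈ Vs j, f w = z := by
      intro w hw
      have hwL := hVL w hw
      rcases hst w (Or.inr hw) (fun h => hUnL _ hzU (h ▸ hwL)) with h | h
      · exact absurd (h.2 ▸ hwL) (hUnL _ (hpm z))
      · rw [← hpL w hwL]; exact h.2
    have hpath : ∀ i < k, i ≠ idx z → i + 1 = idx z ∨ idx z + 1 = i := by
      intro i hi hiz
      have h1 := hu i hi
      rcases hst (u i) (Or.inl h1.1) (fun h => hiz (by rw [← h, h1.2])) with h | h
      · left
        have := hpi z hzU h.1
        rw [h.2, h1.2] at this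
        exact this
      · right
        have := hpi _ h1.1 h.1
        rw [h.2, h1.2] at this
        exact this
    have hzk := hidx z hzU
    have a0 := hpath 0 (by omega)
    have a1 := hpath 1 (by omega)
    have hx1 := hleaf _ (hx j)
    have hy1 := hleaf _ (hy j)
    rcases (by omega : k = 2 ∨ k = 3 ∨ 4 ≤ k) with h2 | h3 | h4
    · exact hfx (by omega) j (by rw [hx1, ← hy1]; exact hfy h2 j)
    · have a2 := hpath 2 (by omega)
      have : idx z = 1 := by omega
      exact hfx (by omega) j (by rw [hx1, ← this, hzk.2])
    · have a2 := hpath 2 (by omega)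
      have a3 := hpath 3 (by omega)
      omega
end

section
/- Under the hypotheses that D and F are tree degree sequences with min(d_i,f_i)=1 for all i and no degree equal to n−1, the probability that two independent uniformly random trees realizing D and F are edge-disjoint is at least ((d_{i_1}−1)(d_{i_2}−1)(f_{j_1}−1)(f_{j_2}−1)) / ((n−2)^2 (n−3)^2), where i_1 ≠ i_2 are indices with d-degree > 1 and j_1 ≠ j_2 are indices with f-degree > 1. -/
def CT {V : Type} (a : V → ℕ) : Set (SimpleGraph V) :=
  {G | G.Connected ∧ ∀ v, {u | G.Adj v u}.ncard = a v + 1}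

lemma conn_iff {V : Type} [Fintype V] (G : SimpleGraph V) (v u : V) (huv : u ≠ v)
    (h : ∀ x, G.Adj v x ↔ x = u) : G.Connected ↔ (G.induce {v}ᶜ).Connected := by
  classical
  constructor
  · intro hc
    apply hc.induce_compl_singleton_of_degree_eq_one
    rw [SimpleGraph.degree_eq_one_iff_existsUnique_adj]
    exact ⟨u, (h u).2 rfl, fun y hy => (h y).1 hy⟩
  · intro hc
    rw [SimpleGraph.connected_iff_exists_forall_reachable]
    refine ⟨u, fun w => ?_⟩
    by_cases hw : w = v
    · subst hw
      exact ((h u).2 rfl).symm.reachable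
    · exact (hc.preconnected ⟨u, huv⟩ ⟨w, hw⟩).map (SimpleGraph.Embedding.induce _).toHom

lemma adj_iff_of_leaf {V : Type} [Fintype V] (G : SimpleGraph V) (v u : V)
    (h1 : {x | G.Adj v x}.ncard = 1) (huv : G.Adj v u) (x : V) : G.Adj v x ↔ x = u := by
  obtain ⟨y, hy⟩ := Set.ncard_eq_one.1 h1
  have h2 : ∀ z, G.Adj v z ↔ z = y := fun z => by
    have := Set.ext_iff.1 hy z
    simpa using this
  rw [h2] at huv ⊢
  subst huv; rfl

lemma leaf_leaf {V : Type} [Fintype V] (G : SimpleGraph V) (hG : G.Connected) (v u : V)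
    (hV : 3 ≤ Fintype.card V)
    (h1 : {x | G.Adj v x}.ncard = 1) (h2 : {x | G.Adj u x}.ncard = 1) : ¬ G.Adj v u := by
  classical
  intro huv
  have hne : u ≠ v := huv.ne'
  have hv := adj_iff_of_leaf G v u h1 huv
  have hu := adj_iff_of_leaf G u v h2 huv.symm
  have hc := (conn_iff G v u hne hv).1 hG
  obtain ⟨w, hw⟩ : ∃ w, w ∉ ({u, v} : Finset V) := by
    by_contra! hcon
    have := Finset.card_le_card (fun x _ => hcon x : (Finset.univ : Finset V) ⊆ {u, v})
    have := Finset.card_le_two (a := u) (b := v)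
    rw [Finset.card_univ] at *
    omega
  simp only [Finset.mem_insert, Finset.mem_singleton, not_or] at hw
  have : Nontrivial ↥({v}ᶜ : Set V) := ⟨⟨u, hne⟩, ⟨w, hw.2⟩, fun h => hw.1 (by simpa using (congrArg Subtype.val h).symm)⟩
  obtain ⟨⟨z, hz⟩, hz'⟩ := hc.preconnected.exists_adj_of_nontrivial ⟨u, hne⟩
  have : G.Adj u z := hz'
  exact hz ((hu z).1 this)

lemma deg_induce {V : Type} [Fintype V] [DecidableEq V] (G : SimpleGraph V) (v u : V)
    (h : ∀ x, G.Adj v x ↔ x = u) (w : ↥({v}ᶜ : Set V)) :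
    {x | G.Adj w.1 x}.ncard = {x | (G.induce {v}ᶜ).Adj w x}.ncard + if w.1 = u then 1 else 0 := by
  have e : {x | (G.induce {v}ᶜ).Adj w x}.ncard = ({x | G.Adj w.1 x} \ {v}).ncard := by
    rw [← Set.ncard_image_of_injective _ Subtype.val_injective]
    congr 1
    ext x
    simp
  rw [e]
  have hs : G.Adj w.1 v ↔ w.1 = u := by rw [G.adj_comm]; exact h _
  split_ifs with hw
  · exact (Set.ncard_sdiff_singleton_add_one (by simpa using hs.2 hw)).symm
  · rw [Set.sdiff_singleton_eq_self]; rfl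
    simpa [hs] using hw

lemma remove_leaf {V : Type} [Fintype V] [DecidableEq V] (a : V → ℕ) (v u : V) (huv : u ≠ v)
    (hv : a v = 0) (hu : 1 ≤ a u) (P : SimpleGraph ↥({v}ᶜ : Set V) → Prop) :
    {G | G ∈ CT a ∧ G.Adj v u ∧ P (G.induce {v}ᶜ)}.ncard =
    {G | G ∈ CT (fun w : ↥({v}ᶜ : Set V) => if w.1 = u then a w.1 - 1 else a w.1) ∧ P G}.ncard := by
  apply Set.ncard_congr (fun G _ => G.induce {v}ᶜ)
  · rintro G ⟨⟨hc, hd⟩, hadj, hP⟩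
    have h := adj_iff_of_leaf G v u (by rw [hd, hv]) hadj
    refine ⟨⟨(conn_iff G v u huv h).1 hc, fun w => ?_⟩, hP⟩
    have := deg_induce G v u h w
    rw [hd] at this
    simp only
    split_ifs at this ⊢ with hw
    · rw [hw] at this ⊢; omega
    · omega
  · rintro G H ⟨⟨hc, hd⟩, hadj, hP⟩ ⟨⟨hc', hd'⟩, hadj', hP'⟩ heq
    have h := adj_iff_of_leaf G v u (by rw [hd, hv]) hadj
    have h' := adj_iff_of_leaf H v u (by rw [hd', hv]) hadj'
    ext x y
    by_cases hx : x = v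
    · subst hx; rw [h, h']
    by_cases hy : y = v
    · subst hy; rw [G.adj_comm, H.adj_comm, h, h']
    have := congrArg (fun K => K.Adj ⟨x, hx⟩ ⟨y, hy⟩) heq
    simpa using this
  · rintro K ⟨⟨hc, hd⟩, hP⟩
    let G : SimpleGraph V :=
      { Adj := fun x y => (∃ hx hy, K.Adj ⟨x, hx⟩ ⟨y, hy⟩) ∨ (x = v ∧ y = u) ∨ (x = u ∧ y = v)
        symm := ⟨by
          rintro x y (⟨hx, hy, h⟩ | h | h)
          · exact Or.inl ⟨hy, hx, h.symm⟩
          · exact Or.inr (Or.inr h.symm)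
          · exact Or.inr (Or.inl h.symm)⟩
        loopless := ⟨by
          rintro x (⟨hx, hy, h⟩ | h | h)
          · exact K.loopless.irrefl _ h
          · exact huv (h.2.symm.trans h.1)
          · exact huv (h.1.symm.trans h.2)⟩ }
    have hGi : G.induce {v}ᶜ = K := by
      ext ⟨x, hx⟩ ⟨y, hy⟩
      have hx' : x ≠ v := hx
      have hy' : y ≠ v := hy
      simp [G, hx', hy']
    have h : ∀ x, G.Adj v x ↔ x = u := by
      intro x
      simp [G, huv.symm]
    refine ⟨G, ⟨⟨(conn_iff G v u huv h).2 (hGi ▸ hc), fun w => ?_⟩, (h u).2 rfl, hGi ▸ hP⟩, hGi⟩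
    by_cases hw : w = v
    · subst hw
      simp [h, hv]
    · have := deg_induce G v u h ⟨w, hw⟩
      rw [hGi, hd] at this
      simp only at this
      rw [this]
      split_ifs with hwu
      · subst hwu; omega
      · omega

lemma ncard_filter_eq {α : Type} [Finite α] (s : Set α) (p : α → Prop) [DecidablePred p] :
    {x | x ∈ s ∧ p x}.ncard = (s.toFinite.toFinset.filter p).card := by
  rw [← Set.ncard_coe_finset]
  congr 1
  ext x
  simp

lemma ncard_eq_sum_leaf {V : Type} [Fintype V] [DecidableEq V] (a : V → ℕ) (v : V)
    (hv : a v = 0) : (CT a).ncard = ∑ u, {G | G ∈ CT a ∧ G.Adj v u}.ncard := by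
  classical
  rw [Set.ncard_eq_toFinset_card _ (Set.toFinite _), Finset.card_eq_sum_ones]
  simp_rw [ncard_filter_eq, Finset.card_filter]
  rw [Finset.sum_comm]
  refine Finset.sum_congr rfl fun G hG => ?_
  have hG' : G ∈ CT a := by simpa using hG
  have := hG'.2 v
  rw [hv, zero_add] at this
  rw [← Finset.card_filter, ← this, ← Set.ncard_coe_finset]
  simp

lemma sub_facts {V : Type} [Fintype V] [DecidableEq V] (a : V → ℕ) (v u : V) (huv : u ≠ v)
    (hv : a v = 0) (hu : 1 ≤ a u) (m : ℕ) (hV : Fintype.card V = m + 3) (hs : ∑ i, a i = m + 1) :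
    Fintype.card ↥({v}ᶜ : Set V) = m + 2 ∧
    (∑ w : ↥({v}ᶜ : Set V), if w.1 = u then a w.1 - 1 else a w.1) = m ∧
    (∏ i, (a i).factorial) =
      a u * ∏ w : ↥({v}ᶜ : Set V), (if w.1 = u then a w.1 - 1 else a w.1).factorial := by
  have hsplit : ∀ {M : Type} [CommMonoid M] (f : V → M),
      ∏ i, f i = f v * ∏ w : ↥({v}ᶜ : Set V), f w.1 := by
    intro M _ f
    rw [Fintype.prod_eq_mul_prod_compl v]
    congr 1
    exact Finset.prod_subtype _ (by simp) f
  have hsplit' : ∀ (f : V → ℕ),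
      ∑ i, f i = f v + ∑ w : ↥({v}ᶜ : Set V), f w.1 := by
    intro f
    rw [Fintype.sum_eq_add_sum_compl v]
    congr 1
    exact Finset.sum_subtype _ (by simp) f
  refine ⟨?_, ?_, ?_⟩
  · have := Fintype.card_compl_set ({v} : Set V)
    simp only [Fintype.card_unique] at this
    rw [this, hV]
    omega
  · have h1 := hsplit' a
    rw [hv, zero_add, hs] at h1
    have h2 : ∑ w : ↥({v}ᶜ : Set V), a w.1 =
        (∑ w : ↥({v}ᶜ : Set V), if w.1 = u then a w.1 - 1 else a w.1) +
        ∑ w : ↥({v}ᶜ : Set V), if w = ⟨u, huv⟩ then 1 else 0 := by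
      rw [← Finset.sum_add_distrib]
      refine Finset.sum_congr rfl fun w _ => ?_
      by_cases hw : w.1 = u
      · have : w = ⟨u, huv⟩ := Subtype.ext hw
        subst this
        simp; omega
      · have : w ≠ ⟨u, huv⟩ := fun h => hw (congrArg Subtype.val h)
        simp [hw, this]
    rw [Finset.sum_ite_eq' Finset.univ] at h2
    simp only [Finset.mem_univ, if_true] at h2
    omega
  · rw [hsplit (fun i => (a i).factorial), hv, Nat.factorial_zero, one_mul]
    rw [Fintype.prod_eq_mul_prod_compl (⟨u, huv⟩ : ↥({v}ᶜ : Set V)),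
      Fintype.prod_eq_mul_prod_compl (⟨u, huv⟩ : ↥({v}ᶜ : Set V)), ← mul_assoc]
    congr 1
    · simp only [if_true]
      exact (Nat.mul_factorial_pred (by omega)).symm
    · refine Finset.prod_congr rfl fun w hw => ?_
      have : w.1 ≠ u := by
        intro h
        simp at hw
        exact hw (Subtype.ext h)
      simp [this]

lemma leaf_count_aux (m : ℕ)
    (ih : ∀ (V : Type) [Fintype V] [DecidableEq V] (a : V → ℕ), Fintype.card V = m + 2 →
      ∑ i, a i = m → (CT a).ncard * ∏ i, (a i).factorial = m.factorial)
    (V : Type) [Fintype V] [DecidableEq V] (a : V → ℕ) (hV : Fintype.card V = m + 3)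
    (hs : ∑ i, a i = m + 1) (v u : V) (hv : a v = 0) :
    {G | G ∈ CT a ∧ G.Adj v u}.ncard * ∏ i, (a i).factorial = a u * m.factorial := by
  have hempty : (∀ G ∈ CT a, ¬ G.Adj v u) → a u = 0 →
      {G | G ∈ CT a ∧ G.Adj v u}.ncard * ∏ i, (a i).factorial = a u * m.factorial := by
    intro h h0
    have : {G | G ∈ CT a ∧ G.Adj v u} = ∅ := by
      ext G; simpa using h G
    rw [this, h0]; simp
  by_cases huv : u = v
  · subst huv
    exact hempty (fun G _ => G.loopless.irrefl _) hv
  by_cases hu : a u = 0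
  · refine hempty (fun G hG => ?_) hu
    exact leaf_leaf G hG.1 v u (by omega) (by rw [hG.2, hv]) (by rw [hG.2, hu])
  have hr := remove_leaf a v u huv hv (by omega) (fun _ => True)
  simp only [and_true, Set.ofPred_mem_eq] at hr
  obtain ⟨f1, f2, f3⟩ := sub_facts a v u huv hv (by omega) m hV hs
  have := ih _ _ f1 f2
  rw [hr, f3, ← this]
  ring

lemma tree_count (m : ℕ) : ∀ (V : Type) [Fintype V] [DecidableEq V] (a : V → ℕ),
    Fintype.card V = m + 2 →
      ∑ i, a i = m → (CT a).ncard * ∏ i, (a i).factorial = m.factorial := by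
  induction m with
  | zero =>
    intro V _ _ a hV hs
    have ha : ∀ i, a i = 0 := by simpa using hs
    have : CT a = {⊤} := by
      have : Nonempty V := Fintype.card_pos_iff.1 (by omega)
      have hn : ∀ v : V, {u | (⊤ : SimpleGraph V).Adj v u}.ncard = 1 := by
        intro v
        have : {u | (⊤ : SimpleGraph V).Adj v u} = {v}ᶜ := by
          ext; simp [eq_comm]
        rw [this, Set.ncard_compl, Nat.card_eq_fintype_card, hV]
        simp
      ext G
      simp only [Set.mem_singleton_iff]
      constructor
      · rintro ⟨hc, hd⟩
        ext x y
        have h1 : {u | G.Adj x u} = {u | (⊤ : SimpleGraph V).Adj x u} := by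
          apply Set.eq_of_subset_of_ncard_le
          · intro u hu; exact hu.ne
          · rw [hn, hd, ha]
          · exact Set.toFinite _
        exact Set.ext_iff.1 h1 y
      · rintro rfl
        exact ⟨SimpleGraph.connected_top, fun v => by rw [hn, ha]⟩
    rw [this]
    simp [ha]
  | succ m ih =>
    intro V _ _ a hV hs
    obtain ⟨v, hv⟩ : ∃ v, a v = 0 := by
      by_contra! hcon
      have : ∑ i : V, 1 ≤ ∑ i, a i := Finset.sum_le_sum fun i _ => Nat.one_le_iff_ne_zero.2 (hcon i)
      simp at this
      omega
    rw [ncard_eq_sum_leaf a v hv, Finset.sum_mul,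
      Finset.sum_congr rfl fun u _ => leaf_count_aux m ih V a hV hs v u hv, ← Finset.sum_mul, hs,
      Nat.factorial_succ]

lemma leaf_count (m : ℕ) (V : Type) [Fintype V] [DecidableEq V] (a : V → ℕ)
    (hV : Fintype.card V = m + 3)
    (hs : ∑ i, a i = m + 1) (v u : V) (hv : a v = 0) :
    {G | G ∈ CT a ∧ G.Adj v u}.ncard * (m + 1) = a u * (CT a).ncard := by
  have h1 := leaf_count_aux m (tree_count m) V a hV hs v u hv
  have h2 := tree_count (m + 1) V a hV hs
  have hp : 0 < ∏ i, (a i).factorial := Finset.prod_pos fun i _ => Nat.factorial_pos _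
  rw [Nat.factorial_succ] at h2
  apply Nat.eq_of_mul_eq_mul_right hp
  calc _ = (m + 1) * ({G | G ∈ CT a ∧ G.Adj v u}.ncard * ∏ i, (a i).factorial) := by ring
    _ = a u * ((m + 1) * m.factorial) := by rw [h1]; ring
    _ = _ := by rw [← h2]; ring

lemma two_leaf_count (m : ℕ) (V : Type) [Fintype V] [DecidableEq V] (a : V → ℕ)
    (hV : Fintype.card V = m + 4)
    (hs : ∑ i, a i = m + 2) (v u w x : V) (hv : a v = 0) (hw : a w = 0) (hu : 1 ≤ a u)
    (huv : u ≠ v) (hwv : w ≠ v) (hxv : x ≠ v) (hwu : w ≠ u) (hxu : x ≠ u) :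
    {G | G ∈ CT a ∧ G.Adj v u ∧ G.Adj w x}.ncard * ((m + 2) * (m + 1)) =
      a u * a x * (CT a).ncard := by
  have hr := remove_leaf a v u huv hv hu (fun G => G.Adj ⟨w, hwv⟩ ⟨x, hxv⟩)
  simp only [SimpleGraph.comap_adj, Function.Embedding.subtype_apply] at hr
  obtain ⟨f1, f2, f3⟩ := sub_facts a v u huv hv hu (m + 1) hV hs
  have h1 := leaf_count_aux m (tree_count m) _ _ f1 f2 ⟨w, hwv⟩ ⟨x, hxv⟩ (by simp [hwu, hw])
  have h2 := tree_count (m + 2) V a hV hs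
  rw [← hr] at h1
  simp only [hxu, if_false] at h1
  have hp : 0 < ∏ i, (a i).factorial := Finset.prod_pos fun i _ => Nat.factorial_pos _
  apply Nat.eq_of_mul_eq_mul_right hp
  rw [mul_assoc (a u * a x), h2, Nat.factorial_succ, Nat.factorial_succ, f3]
  generalize (∏ w : ↥({v}ᶜ : Set V), (if w.1 = u then a w.1 - 1 else a w.1).factorial) = p at *
  generalize {G | G ∈ CT a ∧ G.Adj v u ∧ G.Adj w x}.ncard = c at *
  calc _ = (m + 2) * (m + 1) * a u * (c * p) := by ring
    _ = _ := by rw [h1]; ring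

lemma tree_set_eq {n : ℕ} (hn : 1 ≤ n) (D : Fin n → ℕ) (hD : isTreeSeq D) (G : SimpleGraph (Fin n)) :
    (G.IsTree ∧ realizes G D) ↔ G ∈ CT (fun i => D i - 1) := by
  classical
  have hd : realizes G D ↔ ∀ v, {u | G.Adj v u}.ncard = D v - 1 + 1 := by
    refine forall_congr' fun v => ?_
    have := hD.1 v
    rw [Nat.sub_add_cancel this]
  rw [CT, Set.mem_ofPred_eq, ← hd]
  refine and_congr_left fun hr => ?_
  rw [SimpleGraph.isTree_iff_connected_and_card, and_iff_left]
  have h1 := G.sum_degrees_eq_twice_card_edges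
  have h2 : ∑ v, G.degree v = ∑ v, D v := by
    refine Finset.sum_congr rfl fun v _ => ?_
    rw [← hr v, ← SimpleGraph.card_neighborFinset_eq_degree, ← Set.ncard_coe_finset]
    simp [SimpleGraph.neighborSet]
  rw [h2, hD.2] at h1
  rw [Nat.card_eq_fintype_card, ← SimpleGraph.edgeFinset_card]
  simp
  omega

lemma sum_pred {n : ℕ} (D : Fin n → ℕ) (hD : isTreeSeq D) : ∑ i, (D i - 1) = n - 2 := by
  have : ∑ i, (D i - 1) + ∑ i : Fin n, 1 = ∑ i, D i := by
    rw [← Finset.sum_add_distrib]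
    exact Finset.sum_congr rfl fun i _ => Nat.sub_add_cancel (hD.1 i)
  rw [hD.2] at this
  simp at this
  omega

lemma count_main {n m : ℕ} (hnm : n = m + 4) (a b : Fin n → ℕ)
    (ha : ∑ i, a i = m + 2) (hb : ∑ i, b i = m + 2) (hab : ∀ i, a i = 0 ∨ b i = 0)
    (i₁ i₂ j₁ j₂ : Fin n) (hi : i₁ ≠ i₂)
    (hi₁ : a i₁ ≠ 0) (hi₂ : a i₂ ≠ 0) (hj₁ : b j₁ ≠ 0) (hj₂ : b j₂ ≠ 0) :
    {G | G ∈ CT a ∧ G.Adj j₁ i₁ ∧ G.Adj j₂ i₂}.ncard *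
      {G | G ∈ CT b ∧ G.Adj i₁ j₁ ∧ G.Adj i₂ j₂}.ncard ≤
    {P : SimpleGraph (Fin n) × SimpleGraph (Fin n) | P.1 ∈ CT a ∧ P.2 ∈ CT b ∧
      Disjoint P.1.edgeSet P.2.edgeSet}.ncard := by
  classical
  have hcard : Fintype.card (Fin n) = m + 1 + 3 := by simp [hnm]
  set TA := (CT a).toFinite.toFinset with hTA
  set TB := (CT b).toFinite.toFinset with hTB
  have mTA : ∀ G, G ∈ TA ↔ G ∈ CT a := by simp [hTA]
  have mTB : ∀ G, G ∈ TB ↔ G ∈ CT b := by simp [hTB]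
  let Q : Finset (Fin n × Fin n) := Finset.univ.filter fun q => a q.1 ≠ 0 ∧ b q.2 ≠ 0
  let Y : SimpleGraph (Fin n) × SimpleGraph (Fin n) → ℕ := fun P =>
    (Q.filter fun q => P.1.Adj q.2 q.1 ∧ P.2.Adj q.1 q.2).card
  -- the expected number of common edges is one
  have hE : ∑ P ∈ TA ×ˢ TB, Y P = (TA ×ˢ TB).card := by
    have e1 : ∑ P ∈ TA ×ˢ TB, Y P = ∑ q ∈ Q,
        {G | G ∈ CT a ∧ G.Adj q.2 q.1}.ncard * {G | G ∈ CT b ∧ G.Adj q.1 q.2}.ncard := by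
      simp only [Y, Finset.card_filter]
      rw [Finset.sum_comm]
      refine Finset.sum_congr rfl fun q _ => ?_
      rw [ncard_filter_eq, ncard_filter_eq, ← Finset.card_product, ← Finset.card_filter]
      congr 1
      ext P
      simp [TA, TB]
      tauto
    have e2 : (∑ P ∈ TA ×ˢ TB, Y P) * ((m + 2) * (m + 2)) =
        ∑ q ∈ Q, (a q.1 * b q.2) * (TA.card * TB.card) := by
      rw [e1, Finset.sum_mul]
      refine Finset.sum_congr rfl fun q hq => ?_
      have hq' : a q.1 ≠ 0 ∧ b q.2 ≠ 0 := by simpa [Q] using hq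
      have h1 := leaf_count (m + 1) (Fin n) a hcard ha q.2 q.1 ((hab q.2).resolve_right hq'.2)
      have h2 := leaf_count (m + 1) (Fin n) b hcard hb q.1 q.2 ((hab q.1).resolve_left hq'.1)
      rw [Set.ncard_eq_toFinset_card (CT a) (Set.toFinite _), ← hTA] at h1
      rw [Set.ncard_eq_toFinset_card (CT b) (Set.toFinite _), ← hTB] at h2
      calc _ = ({G | G ∈ CT a ∧ G.Adj q.2 q.1}.ncard * (m + 1 + 1)) *
            ({G | G ∈ CT b ∧ G.Adj q.1 q.2}.ncard * (m + 1 + 1)) := by ring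
        _ = _ := by rw [h1, h2]; ring
    have e3 : ∑ q ∈ Q, (a q.1 * b q.2) = (m + 2) * (m + 2) := by
      rw [Finset.sum_filter_of_ne, ← Finset.univ_product_univ, Finset.sum_product,
        ← Finset.sum_mul_sum, ha, hb]
      intro q _ h
      exact mul_ne_zero_iff.1 h
    rw [← Finset.sum_mul, e3] at e2
    rw [Finset.card_product]
    apply Nat.eq_of_mul_eq_mul_right (show 0 < (m + 2) * (m + 2) by positivity)
    rw [e2]; ring
  let B := (TA ×ˢ TB).filter fun P =>
    (P.1.Adj j₁ i₁ ∧ P.1.Adj j₂ i₂) ∧ (P.2.Adj i₁ j₁ ∧ P.2.Adj i₂ j₂)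
  let Z := (TA ×ˢ TB).filter fun P => Y P = 0
  have hBZ : B.card ≤ Z.card := by
    have : (TA ×ˢ TB).card + B.card ≤ ∑ P ∈ TA ×ˢ TB, Y P + Z.card := by
      simp only [B, Z, Finset.card_filter]
      rw [Finset.card_eq_sum_ones, ← Finset.sum_add_distrib, ← Finset.sum_add_distrib]
      refine Finset.sum_le_sum fun P hP => ?_
      by_cases hB : (P.1.Adj j₁ i₁ ∧ P.1.Adj j₂ i₂) ∧ (P.2.Adj i₁ j₁ ∧ P.2.Adj i₂ j₂)
      · have : 2 ≤ Y P := by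
          have hsub : ({(i₁, j₁), (i₂, j₂)} : Finset (Fin n × Fin n)) ⊆
              (Q.filter fun q => P.1.Adj q.2 q.1 ∧ P.2.Adj q.1 q.2) := by
            intro q hq
            simp only [Finset.mem_insert, Finset.mem_singleton] at hq
            rcases hq with rfl | rfl
            · simp [Q, hi₁, hj₁, hB]
            · simp [Q, hi₂, hj₂, hB]
          have := Finset.card_le_card hsub
          rwa [Finset.card_pair (fun h => hi (congrArg Prod.fst h))] at this
        rw [if_pos hB]; omega
      · rw [if_neg hB]
        split_ifs <;> omega
    rw [hE] at this
    omega
  have hBc : B.card = {G | G ∈ CT a ∧ G.Adj j₁ i₁ ∧ G.Adj j₂ i₂}.ncard *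
      {G | G ∈ CT b ∧ G.Adj i₁ j₁ ∧ G.Adj i₂ j₂}.ncard := by
    rw [ncard_filter_eq, ncard_filter_eq, ← Finset.card_product]
    congr 1
    ext P
    simp [B, TA, TB]
    tauto
  rw [← hBc]
  refine hBZ.trans ?_
  rw [← Set.ncard_coe_finset]
  apply Set.ncard_le_ncard _ (Set.toFinite _)
  intro P hP
  have hP' : (P.1 ∈ CT a ∧ P.2 ∈ CT b) ∧ Y P = 0 := by simpa [Z, TA, TB] using hP
  obtain ⟨⟨hPa, hPb⟩, hY⟩ := hP'
  refine ⟨hPa, hPb, ?_⟩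
  rw [Set.disjoint_left]
  intro e
  induction e with | _ u v
  intro h1 h2
  have h1 : P.1.Adj u v := h1
  have h2 : P.2.Adj u v := h2
  have hY' : ∀ q : Fin n × Fin n, a q.1 ≠ 0 → b q.2 ≠ 0 → P.1.Adj q.2 q.1 → ¬ P.2.Adj q.1 q.2 := by
    intro q hq1 hq2 hq3 hq4
    have := Finset.card_eq_zero.1 hY
    have hm : q ∈ (Q.filter fun q => P.1.Adj q.2 q.1 ∧ P.2.Adj q.1 q.2) := by
      simp [Q, hq1, hq2, hq3, hq4]
    rw [this] at hm
    simp at hm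
  have ka : ¬ (a u = 0 ∧ a v = 0) := fun h =>
    leaf_leaf P.1 hPa.1 u v (by omega) (by rw [hPa.2, h.1]) (by rw [hPa.2, h.2]) h1
  have kb : ¬ (b u = 0 ∧ b v = 0) := fun h =>
    leaf_leaf P.2 hPb.1 u v (by omega) (by rw [hPb.2, h.1]) (by rw [hPb.2, h.2]) h2
  have hu := hab u
  have hv := hab v
  by_cases hau : a u = 0
  · have hav : a v ≠ 0 := fun h => ka ⟨hau, h⟩
    have hbu : b u ≠ 0 := fun h => kb ⟨h, hv.resolve_left hav⟩
    exact hY' (v, u) hav hbu h1 h2.symm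
  · have hbv : b v ≠ 0 := fun h => kb ⟨hu.resolve_left hau, h⟩
    exact hY' (u, v) hau hbv h1.symm h2

theorem prob_edge_disjoint_lower_bound (n : ℕ) (D F : Fin n → ℕ)
    (hD : isTreeSeq D) (hF : isTreeSeq F) (hmin : ∀ i, min (D i) (F i) = 1)
    (hDs : ∀ i, D i ≠ n - 1) (hFs : ∀ i, F i ≠ n - 1)
    (i₁ i₂ j₁ j₂ : Fin n) (hi : i₁ ≠ i₂) (hj : j₁ ≠ j₂)
    (hDi₁ : 1 < D i₁) (hDi₂ : 1 < D i₂) (hFj₁ : 1 < F j₁) (hFj₂ : 1 < F j₂) :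
    (((D i₁ : ℚ) - 1) * ((D i₂ : ℚ) - 1) * ((F j₁ : ℚ) - 1) * ((F j₂ : ℚ) - 1)) /
        (((n : ℚ) - 2) ^ 2 * ((n : ℚ) - 3) ^ 2) ≤
      ({P : SimpleGraph (Fin n) × SimpleGraph (Fin n) |
          P.1.IsTree ∧ realizes P.1 D ∧ P.2.IsTree ∧ realizes P.2 F ∧
          Disjoint P.1.edgeSet P.2.edgeSet}.ncard : ℚ) /
        (({T : SimpleGraph (Fin n) | T.IsTree ∧ realizes T D}.ncard : ℚ) *
         ({T : SimpleGraph (Fin n) | T.IsTree ∧ realizes T F}.ncard : ℚ)) := by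
  have hDF : ∀ i, D i - 1 = 0 ∨ F i - 1 = 0 := by
    intro i
    have := hmin i
    omega
  have hij : ∀ i j, 1 < D i → 1 < F j → i ≠ j := by
    intro i j h1 h2 h
    subst h
    have := hmin i
    omega
  have h11 := hij _ _ hDi₁ hFj₁
  have h12 := hij _ _ hDi₁ hFj₂
  have h21 := hij _ _ hDi₂ hFj₁
  have h22 := hij _ _ hDi₂ hFj₂
  obtain ⟨m, hm⟩ : ∃ m, n = m + 4 := by
    have := Finset.card_le_univ ({i₁, i₂, j₁, j₂} : Finset (Fin n))
    rw [Finset.card_insert_of_notMem (by simp [hi, h11, h12]),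
      Finset.card_insert_of_notMem (by simp [h21, h22]), Finset.card_pair hj] at this
    simp at this
    exact ⟨n - 4, by omega⟩
  have hcard : Fintype.card (Fin n) = m + 4 := by simp [hm]
  have sD : ∑ i, (D i - 1) = m + 2 := by rw [sum_pred D hD]; omega
  have sF : ∑ i, (F i - 1) = m + 2 := by rw [sum_pred F hF]; omega
  have eD := tree_set_eq (by omega) D hD
  have eF := tree_set_eq (by omega) F hF
  have q1 : {T : SimpleGraph (Fin n) | T.IsTree ∧ realizes T D} = CT (fun i => D i - 1) :=
    Set.ext eD
  have q2 : {T : SimpleGraph (Fin n) | T.IsTree ∧ realizes T F} = CT (fun i => F i - 1) :=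
    Set.ext eF
  have q3 : {P : SimpleGraph (Fin n) × SimpleGraph (Fin n) |
          P.1.IsTree ∧ realizes P.1 D ∧ P.2.IsTree ∧ realizes P.2 F ∧
          Disjoint P.1.edgeSet P.2.edgeSet} =
      {P : SimpleGraph (Fin n) × SimpleGraph (Fin n) | P.1 ∈ CT (fun i => D i - 1) ∧
        P.2 ∈ CT (fun i => F i - 1) ∧ Disjoint P.1.edgeSet P.2.edgeSet} := by
    ext P
    simp only [Set.mem_ofPred_eq, ← eD, ← eF]
    tauto
  rw [q1, q2, q3]
  have hmain := count_main hm (fun i => D i - 1) (fun i => F i - 1) sD sF hDF i₁ i₂ j₁ j₂ hi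
    (by omega) (by omega) (by omega) (by omega)
  have t1 := two_leaf_count m (Fin n) (fun i => D i - 1) hcard sD j₁ i₁ j₂ i₂
    (by have := hmin j₁; omega) (by have := hmin j₂; omega)
    (by omega) h11 hj.symm h21 h12.symm hi.symm
  have t2 := two_leaf_count m (Fin n) (fun i => F i - 1) hcard sF i₁ j₁ i₂ j₂
    (by have := hmin i₁; omega) (by have := hmin i₂; omega)
    (by omega) h11.symm hi.symm h12.symm h21 hj.symm
  have p1 : 0 < (CT (fun i => D i - 1)).ncard := by
    have := tree_count (m + 2) (Fin n) (fun i => D i - 1) hcard sD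
    refine Nat.pos_of_ne_zero fun h => ?_
    rw [h, zero_mul] at this
    exact Nat.factorial_ne_zero _ this.symm
  have p2 : 0 < (CT (fun i => F i - 1)).ncard := by
    have := tree_count (m + 2) (Fin n) (fun i => F i - 1) hcard sF
    refine Nat.pos_of_ne_zero fun h => ?_
    rw [h, zero_mul] at this
    exact Nat.factorial_ne_zero _ this.symm
  generalize (CT (fun i => D i - 1)).ncard = A at *
  generalize (CT (fun i => F i - 1)).ncard = B at *
  generalize Set.ncard {P : SimpleGraph (Fin n) × SimpleGraph (Fin n) |
    P.1 ∈ CT (fun i => D i - 1) ∧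
        P.2 ∈ CT (fun i => F i - 1) ∧ Disjoint P.1.edgeSet P.2.edgeSet} = X at *
  generalize Set.ncard {G | G ∈ CT (fun i => D i - 1) ∧ G.Adj j₁ i₁ ∧ G.Adj j₂ i₂} = x at *
  generalize Set.ncard {G | G ∈ CT (fun i => F i - 1) ∧ G.Adj i₁ j₁ ∧ G.Adj i₂ j₂} = y at *
  have c1 : ((D i₁ - 1 : ℕ) : ℚ) = (D i₁ : ℚ) - 1 := by push_cast [hDi₁.le]; ring
  have c2 : ((D i₂ - 1 : ℕ) : ℚ) = (D i₂ : ℚ) - 1 := by push_cast [hDi₂.le]; ring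
  have c3 : ((F j₁ - 1 : ℕ) : ℚ) = (F j₁ : ℚ) - 1 := by push_cast [hFj₁.le]; ring
  have c4 : ((F j₂ - 1 : ℕ) : ℚ) = (F j₂ : ℚ) - 1 := by push_cast [hFj₂.le]; ring
  have n2 : (n : ℚ) - 2 = (m : ℚ) + 2 := by rw [hm]; push_cast; ring
  have n3 : (n : ℚ) - 3 = (m : ℚ) + 1 := by rw [hm]; push_cast; ring
  rw [← c1, ← c2, ← c3, ← c4, n2, n3]
  generalize D i₁ - 1 = d1 at *
  generalize D i₂ - 1 = d2 at *
  generalize F j₁ - 1 = f1 at *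
  generalize F j₂ - 1 = f2 at *
  have p1' : (0 : ℚ) < A := by exact_mod_cast p1
  have p2' : (0 : ℚ) < B := by exact_mod_cast p2
  rw [div_le_div_iff₀ (by positivity) (by positivity)]
  have key : d1 * d2 * f1 * f2 * (A * B) ≤ X * ((m + 2) ^ 2 * (m + 1) ^ 2) := by
    calc d1 * d2 * f1 * f2 * (A * B) = (d1 * d2 * A) * (f1 * f2 * B) := by ring
      _ = (x * y) * ((m + 2) ^ 2 * (m + 1) ^ 2) := by rw [← t1, ← t2]; ring
      _ ≤ _ := Nat.mul_le_mul_right _ hmain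
  exact_mod_cast key
end
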